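/- For every q ∈ [2,∞) there exists a constant c_q > 0, depending only on q and s, such that for every summable f : ℤ → ℝ one has ‖G̃(f)‖_q ≤ c_q ‖f‖_q and ‖H(f)‖_q ≤ c_q ‖f‖_q, where G̃(f)(x) = (∫₀^∞ |∇̃(P_t f)|²(x) dt)^{1/2} and H(f)(x) = (∫₀^∞ |D(P_t f)(x)|² dt)^{1/2}. -/

import Mathlib

open MeasureTheory Real

/-- The kernel `K_s` of the fractional discrete Laplacian on `ℤ`. -/
noncomputable def Ker (s : ℝ) (m : ℤ) : ℝ :=
  if m = 0 then 0
  else ((4 : ℝ) ^ s * Real.Gamma (1 / 2 + s) / (Real.sqrt Real.pi * |Real.Gamma (-s)|)) *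
    (Real.Gamma ((m.natAbs : ℝ) - s) / Real.Gamma ((m.natAbs : ℝ) + 1 + s))

/-- The fractional discrete Laplacian `L = (-Δ)^s` acting pointwise. -/
noncomputable def Lop (s : ℝ) (f : ℤ → ℝ) : ℤ → ℝ :=
  fun x => ∑' y : ℤ, (f x - f y) * Ker s (x - y)

/-- The heat semigroup `P_t = exp (-t L)`, given by the exponential series of the
bounded operator `-tL` (evaluated pointwise). -/
noncomputable def heat (s t : ℝ) (f : ℤ → ℝ) : ℤ → ℝ :=
  fun x => ∑' n : ℕ, ((-t) ^ n / (n.factorial : ℝ)) * ((Lop s)^[n] f x)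

/-- The squared modulus of the gradient, `|∇f|²(x) = Σ_y K_s(y-x) (f x - f y)²`. -/
noncomputable def gradSq (s : ℝ) (f : ℤ → ℝ) (x : ℤ) : ℝ :=
  ∑' y : ℤ, Ker s (y - x) * (f x - f y) ^ 2

/-- The squared modulus of the modified gradient,
`|∇̃f|²(x) = Σ_{y : |f y| < |f x|} K_s(y-x) (f x - f y)²`. -/
noncomputable def mgradSq (s : ℝ) (f : ℤ → ℝ) (x : ℤ) : ℝ :=
  ∑' y : {y : ℤ // |f y| < |f x|}, Ker s ((y : ℤ) - x) * (f x - f (y : ℤ)) ^ 2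

/-- The `ℓ^q` norm on `ℤ` with counting measure (for finite `q`). -/
noncomputable def lqNorm (q : ℝ) (f : ℤ → ℝ) : ℝ :=
  (∑' x : ℤ, |f x| ^ q) ^ (1 / q)

theorem Ker_zero (s : ℝ) : Ker s 0 = 0 := by simp [Ker]

theorem Ker_neg (s : ℝ) (m : ℤ) : Ker s (-m) = Ker s m := by simp [Ker]

theorem Ker_coeff_pos {s : ℝ} (hs : s ∈ Set.Ioo (0 : ℝ) 1) :
    0 < (4 : ℝ) ^ s * Real.Gamma (1 / 2 + s) / (Real.sqrt Real.pi * |Real.Gamma (-s)|) := by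
  obtain ⟨h0, h1⟩ := hs
  have hG : Real.Gamma (-s) ≠ 0 := by
    refine Real.Gamma_ne_zero fun m hm => ?_
    have hm' : s = m := by linarith
    rcases Nat.eq_zero_or_pos m with rfl | hpos
    · simp at hm'; linarith
    · have : (1 : ℝ) ≤ m := by exact_mod_cast hpos
      linarith
  have h2 : 0 < Real.Gamma (1 / 2 + s) := Real.Gamma_pos_of_pos (by linarith)
  have h3 : 0 < |Real.Gamma (-s)| := abs_pos.mpr hG
  have := Real.pi_pos
  positivity

theorem Ker_pos {s : ℝ} (hs : s ∈ Set.Ioo (0 : ℝ) 1) {m : ℤ} (hm : m ≠ 0) : 0 < Ker s m := by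
  have hm1 : (1 : ℝ) ≤ (m.natAbs : ℝ) := by
    exact_mod_cast Nat.one_le_iff_ne_zero.mpr (Int.natAbs_ne_zero.mpr hm)
  rw [Ker, if_neg hm]
  refine mul_pos (Ker_coeff_pos hs) (div_pos ?_ ?_)
  · exact Real.Gamma_pos_of_pos (by linarith [hs.2])
  · exact Real.Gamma_pos_of_pos (by linarith [hs.1])

theorem Ker_nonneg {s : ℝ} (hs : s ∈ Set.Ioo (0 : ℝ) 1) (m : ℤ) : 0 ≤ Ker s m := by
  rcases eq_or_ne m 0 with rfl | hm
  · rw [Ker_zero]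
  · exact (Ker_pos hs hm).le

theorem Gamma_div_Gamma_sub_succ {s x : ℝ} (h0 : 0 < s) (hx : s < x) :
    Real.Gamma (x - s) / Real.Gamma (x + s) - Real.Gamma (x + 1 - s) / Real.Gamma (x + 1 + s) =
      2 * s * (Real.Gamma (x - s) / Real.Gamma (x + 1 + s)) := by
  have h1 : Real.Gamma (x + 1 - s) = (x - s) * Real.Gamma (x - s) := by
    rw [← Real.Gamma_add_one (by linarith)]; ring_nf
  have h2 : Real.Gamma (x + 1 + s) = (x + s) * Real.Gamma (x + s) := by
    rw [← Real.Gamma_add_one (by linarith)]; ring_nf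
  have h3 : Real.Gamma (x + s) ≠ 0 := (Real.Gamma_pos_of_pos (by linarith)).ne'
  have h4 : x + s ≠ 0 := by linarith
  rw [h1, h2]
  field_simp
  ring

theorem summable_Gamma_div_Gamma {s : ℝ} (hs : s ∈ Set.Ioo (0 : ℝ) 1) :
    Summable fun n : ℕ => Real.Gamma ((n : ℝ) + 1 - s) / Real.Gamma ((n : ℝ) + 1 + 1 + s) := by
  obtain ⟨h0, h1⟩ := hs
  have hp : ∀ n : ℕ, 0 < Real.Gamma ((n : ℝ) + 1 - s) := fun n =>
    Real.Gamma_pos_of_pos (by linarith [(n.cast_nonneg : (0 : ℝ) ≤ n)])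
  have hp' : ∀ n : ℕ, 0 < Real.Gamma ((n : ℝ) + 1 + s) := fun n =>
    Real.Gamma_pos_of_pos (by linarith [(n.cast_nonneg : (0 : ℝ) ≤ n)])
  have hp'' : ∀ n : ℕ, 0 < Real.Gamma ((n : ℝ) + 1 + 1 + s) := fun n =>
    Real.Gamma_pos_of_pos (by linarith [(n.cast_nonneg : (0 : ℝ) ≤ n)])
  set a : ℕ → ℝ := fun n => Real.Gamma ((n : ℝ) + 1 - s) / Real.Gamma ((n : ℝ) + 1 + s) with ha
  have hstep : ∀ n : ℕ, a n - a (n + 1) =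
      2 * s * (Real.Gamma ((n : ℝ) + 1 - s) / Real.Gamma ((n : ℝ) + 1 + 1 + s)) := by
    intro n
    have := Gamma_div_Gamma_sub_succ h0 (x := (n : ℝ) + 1)
      (by linarith [(n.cast_nonneg : (0 : ℝ) ≤ n)])
    simpa [ha] using this
  refine summable_of_sum_range_le (c := a 0 / (2 * s)) (fun n => (div_pos (hp n) (hp'' n)).le) ?_
  intro n
  rw [le_div_iff₀ (by linarith), mul_comm, Finset.mul_sum]
  simp_rw [← hstep]
  rw [Finset.sum_range_sub']
  linarith [(div_pos (hp n) (hp' n)).le]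

theorem Ker_summable {s : ℝ} (hs : s ∈ Set.Ioo (0 : ℝ) 1) : Summable (Ker s) := by
  have h : Summable fun n : ℕ => Ker s (n : ℤ) := by
    refine (summable_nat_add_iff 1).mp ?_
    refine ((summable_Gamma_div_Gamma hs).mul_left ((4 : ℝ) ^ s * Real.Gamma (1 / 2 + s) /
      (Real.sqrt Real.pi * |Real.Gamma (-s)|))).congr fun n => ?_
    have hn : ((n + 1 : ℕ) : ℤ) ≠ 0 := by positivity
    rw [Ker, if_neg hn, Int.natAbs_natCast]
    push_cast
    rfl
  exact Summable.of_nat_of_neg h (by simpa only [Ker_neg] using h)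

/-- The Banach space `ℓ¹(ℤ)`. -/
abbrev SeqL1 : Type := lp (fun _ : ℤ => ℝ) 1

namespace SeqL1

theorem summable_abs (F : SeqL1) : Summable fun x => |F x| := by
  simpa using (lp.memℓp F).summable (by simp)

theorem summable (F : SeqL1) : Summable fun x => F x := F.summable_abs.of_abs

theorem norm_eq (F : SeqL1) : ‖F‖ = ∑' x, |F x| := by
  simpa using lp.norm_eq_tsum_rpow (p := 1) (by simp) F

theorem abs_apply_le (F : SeqL1) (x : ℤ) : |F x| ≤ ‖F‖ := by
  simpa using lp.norm_apply_le_norm one_ne_zero F x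

theorem sum_abs_le (F : SeqL1) (S : Finset ℤ) : ∑ x ∈ S, |F x| ≤ ‖F‖ := by
  rw [norm_eq]
  exact F.summable_abs.sum_le_tsum S fun x _ => abs_nonneg _

/-- The element of `ℓ¹(ℤ)` given by a summable function. -/
def mk (f : ℤ → ℝ) (hf : Summable f) : SeqL1 :=
  ⟨f, memℓp_gen (by simpa using hf.abs)⟩

theorem sub_apply (F G : SeqL1) (x : ℤ) : (F - G) x = F x - G x := rfl

theorem smul_apply (c : ℝ) (F : SeqL1) (x : ℤ) : (c • F) x = c * F x := rfl

/-- Evaluation at a point. -/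
noncomputable def eval (x : ℤ) : SeqL1 →L[ℝ] ℝ :=
  LinearMap.mkContinuous
    { toFun := fun F => F x
      map_add' := fun _ _ => rfl
      map_smul' := fun _ _ => rfl } 1 (fun F => by
        rw [one_mul]
        exact F.abs_apply_le x)

@[simp] theorem eval_apply (x : ℤ) (F : SeqL1) : eval x F = F x := rfl

/-- Translation by `z`. -/
noncomputable def shift (z : ℤ) : SeqL1 →L[ℝ] SeqL1 :=
  LinearMap.mkContinuous
    { toFun := fun F => mk (fun x => F (x + z)) (F.summable.comp_injective (add_left_injective z))
      map_add' := fun _ _ => rfl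
      map_smul' := fun _ _ => rfl } 1 (fun F => by
        rw [one_mul, norm_eq, norm_eq]
        exact ((Equiv.addRight z).tsum_eq fun x => |F x|).le)

@[simp] theorem shift_apply (z : ℤ) (F : SeqL1) (x : ℤ) : shift z F x = F (x + z) := rfl

theorem norm_shift_le (z : ℤ) : ‖shift z‖ ≤ 1 :=
  LinearMap.mkContinuous_norm_le _ zero_le_one _

theorem shift_commute (z z' : ℤ) : Commute (shift z) (shift z') := by
  refine ContinuousLinearMap.ext fun F => lp.ext (funext fun x => ?_)
  change F (x + z + z') = F (x + z' + z)
  rw [add_right_comm]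

theorem summable_abs_mul (F G : SeqL1) : Summable fun x => |F x * G x| := by
  refine Summable.of_nonneg_of_le (fun x => abs_nonneg _) (fun x => ?_)
    (F.summable_abs.mul_right ‖G‖)
  rw [abs_mul]
  exact mul_le_mul_of_nonneg_left (G.abs_apply_le x) (abs_nonneg _)

/-- Pointwise multiplication. -/
noncomputable def mulL : SeqL1 →L[ℝ] SeqL1 →L[ℝ] SeqL1 :=
  LinearMap.mkContinuous₂
    (LinearMap.mk₂ ℝ (fun F G : SeqL1 => mk (fun x => F x * G x) (summable_abs_mul F G).of_abs)
      (fun F F' G => lp.ext (funext fun x => add_mul (F x) (F' x) (G x)))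
      (fun c F G => lp.ext (funext fun x => mul_assoc c (F x) (G x)))
      (fun F G G' => lp.ext (funext fun x => mul_add (F x) (G x) (G' x)))
      (fun c F G => lp.ext (funext fun x => mul_left_comm (F x) c (G x)))) 1 (fun F G => by
        rw [one_mul, norm_eq, norm_eq F, ← tsum_mul_right]
        refine (summable_abs_mul F G).tsum_le_tsum (fun x => ?_) (F.summable_abs.mul_right ‖G‖)
        exact (abs_mul (F x) (G x)).trans_le
          (mul_le_mul_of_nonneg_left (G.abs_apply_le x) (abs_nonneg _)))

@[simp] theorem mulL_apply (F G : SeqL1) (x : ℤ) : mulL F G x = F x * G x := rfl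

/-- The operator `F ↦ ∑ z, K z F(· + z)`. -/
noncomputable def conv (K : ℤ → ℝ) : SeqL1 →L[ℝ] SeqL1 := ∑' z, K z • shift z

/-- The generator `F ↦ ∑ z, K z (F - F(· + z))`. -/
noncomputable def gen (K : ℤ → ℝ) : SeqL1 →L[ℝ] SeqL1 := (∑' z, K z) • 1 - conv K

variable {K : ℤ → ℝ}

theorem summable_smul_shift (hK : Summable K) : Summable fun z => K z • shift z := by
  refine Summable.of_norm_bounded hK.abs fun z => ?_
  rw [norm_smul, Real.norm_eq_abs]
  exact mul_le_of_le_one_right (abs_nonneg _) (norm_shift_le z)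

theorem hasSum_conv (hK : Summable K) (F : SeqL1) (x : ℤ) :
    HasSum (fun z => K z * F (x + z)) (conv K F x) := by
  have h1 := (summable_smul_shift hK).hasSum
  have h2 := (ContinuousLinearMap.apply ℝ SeqL1 F).hasSum h1
  exact (eval x).hasSum h2

theorem hasSum_gen (hK : Summable K) (F : SeqL1) (x : ℤ) :
    HasSum (fun z => K z * (F x - F (x + z))) (gen K F x) := by
  have h := (hK.hasSum.mul_right (F x)).sub (hasSum_conv hK F x)
  simp_rw [← mul_sub] at h
  exact h

theorem shift_commute_gen (z : ℤ) : Commute (shift z) (gen K) := by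
  have h1 : Commute (shift z) (conv K) :=
    Commute.tsum_right _ fun z' => (shift_commute z z').smul_right _
  exact ((Commute.one_right _).smul_right _).sub_right h1

/-- The semigroup `exp (-t L)`. -/
noncomputable def semi (K : ℤ → ℝ) (t : ℝ) : SeqL1 →L[ℝ] SeqL1 := NormedSpace.exp (t • -gen K)

theorem hasDerivAt_semi (t : ℝ) : HasDerivAt (semi K) (-(semi K t * gen K)) t := by
  rw [← mul_neg]
  exact hasDerivAt_exp_smul_const (𝕂 := ℝ) (-gen K) t

theorem hasDerivAt_semi' (t : ℝ) : HasDerivAt (semi K) (-(gen K * semi K t)) t := by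
  rw [← neg_mul]
  exact hasDerivAt_exp_smul_const' (𝕂 := ℝ) (-gen K) t

theorem continuous_semi : Continuous (semi K) :=
  continuous_iff_continuousAt.mpr fun t => (hasDerivAt_semi t).continuousAt

theorem semi_zero : semi K 0 = 1 := by simp [semi]

theorem semi_add (a b : ℝ) : semi K (a + b) = semi K a * semi K b := by
  let +nondep : NormedAlgebra ℚ (SeqL1 →L[ℝ] SeqL1) := .restrictScalars ℚ ℝ _
  rw [semi, add_smul, NormedSpace.exp_add_of_commute]
  · rfl
  · exact ((Commute.refl _).smul_left _).smul_right _

theorem shift_commute_semi (z : ℤ) (t : ℝ) : Commute (shift z) (semi K t) :=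
  ((shift_commute_gen z).neg_right.smul_right t).exp_right

theorem hasSum_exp_apply (A : SeqL1 →L[ℝ] SeqL1) (F : SeqL1) (x : ℤ) :
    HasSum (fun n : ℕ => (n.factorial : ℝ)⁻¹ * (A ^ n) F x) (NormedSpace.exp A F x) := by
  have h1 := NormedSpace.exp_series_hasSum_exp' (𝕂 := ℝ) A
  have h2 := (ContinuousLinearMap.apply ℝ SeqL1 F).hasSum h1
  exact (eval x).hasSum h2

theorem exp_conv_nonneg (hK : Summable K) (hK0 : ∀ z, 0 ≤ K z) {t : ℝ} (ht : 0 ≤ t) {F : SeqL1}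
    (hF : ∀ x, 0 ≤ F x) (x : ℤ) : 0 ≤ NormedSpace.exp (t • conv K) F x := by
  have h1 : ∀ n : ℕ, ∀ x, 0 ≤ ((t • conv K) ^ n) F x := by
    intro n
    induction n with
    | zero => exact hF
    | succ n ih =>
      intro x
      rw [pow_succ']
      exact mul_nonneg ht ((hasSum_conv hK _ x).nonneg fun z => mul_nonneg (hK0 z) (ih _))
  exact (hasSum_exp_apply _ F x).nonneg fun n => mul_nonneg (by positivity) (h1 n x)

theorem semi_nonneg (hK : Summable K) (hK0 : ∀ z, 0 ≤ K z) {t : ℝ} (ht : 0 ≤ t) {F : SeqL1}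
    (hF : ∀ x, 0 ≤ F x) (x : ℤ) : 0 ≤ semi K t F x := by
  have hsplit : semi K t = Real.exp (-(t * ∑' z, K z)) • NormedSpace.exp (t • conv K) := by
    let +nondep : NormedAlgebra ℚ (SeqL1 →L[ℝ] SeqL1) := .restrictScalars ℚ ℝ _
    have h : t • -gen K = algebraMap ℝ (SeqL1 →L[ℝ] SeqL1) (-(t * ∑' z, K z)) + t • conv K := by
      rw [gen, Algebra.algebraMap_eq_smul_one, neg_sub, smul_sub, smul_smul, neg_smul]
      abel
    rw [semi, h, NormedSpace.exp_add_of_commute (Algebra.commutes _ _),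
      ← NormedSpace.algebraMap_exp_comm, Real.exp_eq_exp_ℝ, Algebra.algebraMap_eq_smul_one,
      smul_mul_assoc, one_mul]
  rw [hsplit]
  exact mul_nonneg (Real.exp_pos _).le (exp_conv_nonneg hK hK0 ht hF x)

theorem semi_mono (hK : Summable K) (hK0 : ∀ z, 0 ≤ K z) {t : ℝ} (ht : 0 ≤ t) {F G : SeqL1}
    (hFG : ∀ x, F x ≤ G x) (x : ℤ) : semi K t F x ≤ semi K t G x := by
  have h := semi_nonneg hK hK0 ht (F := G - F) (fun x => sub_nonneg.mpr (hFG x)) x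
  rw [map_sub] at h
  exact sub_nonneg.mp h

theorem Lop_coe {s : ℝ} (hs : s ∈ Set.Ioo (0 : ℝ) 1) (F : SeqL1) :
    Lop s (F : ℤ → ℝ) = (gen (Ker s) F : ℤ → ℝ) := by
  funext x
  rw [Lop, ← (Equiv.addLeft x).tsum_eq, ← (hasSum_gen (Ker_summable hs) F x).tsum_eq]
  refine tsum_congr fun z => ?_
  rw [Equiv.coe_addLeft, sub_add_cancel_left, Ker_neg, mul_comm]

theorem Lop_iterate_coe {s : ℝ} (hs : s ∈ Set.Ioo (0 : ℝ) 1) (F : SeqL1) (n : ℕ) :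
    (Lop s)^[n] (F : ℤ → ℝ) = ((gen (Ker s) ^ n) F : ℤ → ℝ) := by
  induction n with
  | zero => rfl
  | succ n ih =>
    rw [Function.iterate_succ_apply', ih, Lop_coe hs, pow_succ']
    rfl

theorem heat_coe {s : ℝ} (hs : s ∈ Set.Ioo (0 : ℝ) 1) (t : ℝ) (F : SeqL1) :
    heat s t (F : ℤ → ℝ) = (semi (Ker s) t F : ℤ → ℝ) := by
  funext x
  rw [heat, semi, ← (hasSum_exp_apply (t • -gen (Ker s)) F x).tsum_eq]
  refine tsum_congr fun n => ?_
  rw [Lop_iterate_coe hs, smul_neg, ← neg_smul, smul_pow, _root_.smul_apply,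
    smul_apply]
  ring

/-- The squared gradient `2 F L F - L (F²)`. -/
noncomputable def carre (K : ℤ → ℝ) (F : SeqL1) : SeqL1 :=
  (2 : ℝ) • mulL F (gen K F) - gen K (mulL F F)

theorem hasSum_carre (hK : Summable K) (F : SeqL1) (x : ℤ) :
    HasSum (fun z => K z * (F x - F (x + z)) ^ 2) (carre K F x) := by
  have h := ((hasSum_gen hK F x).mul_left (2 * F x)).sub (hasSum_gen hK (mulL F F) x)
  have e : carre K F x = 2 * F x * gen K F x - gen K (mulL F F) x := by
    rw [carre, sub_apply, smul_apply, mulL_apply]; ring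
  rw [e]
  refine h.congr_fun fun z => ?_
  rw [mulL_apply, mulL_apply]
  ring

theorem carre_nonneg (hK : Summable K) (hK0 : ∀ z, 0 ≤ K z) (F : SeqL1) (x : ℤ) :
    0 ≤ carre K F x :=
  (hasSum_carre hK F x).nonneg fun z => mul_nonneg (hK0 z) (sq_nonneg _)

theorem continuous_carre : Continuous (carre K) := by
  unfold carre
  fun_prop

theorem hasDerivAt_mulL_self {W : ℝ → SeqL1} {W' : SeqL1} {r : ℝ} (hW : HasDerivAt W W' r) :
    HasDerivAt (fun r => mulL (W r) (W r)) ((2 : ℝ) • mulL (W r) W') r := by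
  have h := (mulL.hasFDerivAt.comp_hasDerivAt r hW).clm_apply hW
  refine h.congr_deriv (lp.ext (funext fun x => ?_))
  change W' x * W r x + W r x * W' x = 2 * (W r x * W' x)
  ring

theorem hasDerivAt_semi_sub (T r : ℝ) (F : SeqL1) :
    HasDerivAt (fun r => semi K (T - r) F) (gen K (semi K (T - r) F)) r := by
  have h1 : HasDerivAt (fun r => T - r) (-1) r := by
    simpa using (hasDerivAt_id r).const_sub T
  have h2 := ((hasDerivAt_semi' (K := K) (T - r)).scomp r h1).clm_apply (hasDerivAt_const r F)
  refine h2.congr_deriv ?_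
  simp

theorem sq_semi_le (hK : Summable K) (hK0 : ∀ z, 0 ≤ K z) {t : ℝ} (ht : 0 ≤ t) (F : SeqL1)
    (x : ℤ) : (semi K t F x) ^ 2 ≤ semi K t (mulL F F) x := by
  have hd : ∀ r : ℝ, HasDerivAt
      (fun r => semi K r (mulL (semi K (t - r) F) (semi K (t - r) F)) x)
      (semi K r (carre K (semi K (t - r) F)) x) r := by
    intro r
    have h := (hasDerivAt_semi (K := K) r).clm_apply
      (hasDerivAt_mulL_self (hasDerivAt_semi_sub (K := K) t r F))
    have h' := (eval x).hasFDerivAt.comp_hasDerivAt r h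
    refine h'.congr_deriv ?_
    rw [eval_apply, carre, map_sub, neg_apply, mul_apply_eq_comp,
      neg_add_eq_sub]
  have hm := monotoneOn_of_hasDerivWithinAt_nonneg (convex_Icc 0 t)
    (fun r _ => (hd r).continuousAt.continuousWithinAt)
    (fun r _ => (hd r).hasDerivWithinAt)
    (fun r hr => semi_nonneg hK hK0 (by rw [interior_Icc] at hr; exact hr.1.le)
      (carre_nonneg hK hK0 _) x)
  have h := hm (Set.left_mem_Icc.mpr ht) (Set.right_mem_Icc.mpr ht) ht
  simpa [semi_zero, sq] using h

theorem carre_semi_le (hK : Summable K) (hK0 : ∀ z, 0 ≤ K z) {t : ℝ} (ht : 0 ≤ t) (F : SeqL1)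
    (x : ℤ) : carre K (semi K t F) x ≤ semi K t (carre K F) x := by
  refine hasSum_le_of_sum_le (hasSum_carre hK _ x) fun S => ?_
  have h1 : ∀ z, K z * (semi K t F x - semi K t F (x + z)) ^ 2 ≤
      semi K t (K z • mulL (F - shift z F) (F - shift z F)) x := by
    intro z
    have hc : semi K t (shift z F) = shift z (semi K t F) :=
      (DFunLike.congr_fun (shift_commute_semi (K := K) z t).eq F).symm
    have h2 := sq_semi_le hK hK0 ht (F - shift z F) x
    rw [map_sub, hc, sub_apply, shift_apply] at h2
    rw [map_smul, smul_apply]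
    exact mul_le_mul_of_nonneg_left h2 (hK0 z)
  refine (Finset.sum_le_sum fun z _ => h1 z).trans ?_
  have h3 : ∑ z ∈ S, semi K t (K z • mulL (F - shift z F) (F - shift z F)) x =
      semi K t (∑ z ∈ S, K z • mulL (F - shift z F) (F - shift z F)) x := by
    simp only [← eval_apply, map_sum]
  rw [h3]
  refine semi_mono hK hK0 ht (fun y => ?_) x
  rw [← eval_apply, map_sum]
  refine le_trans (le_of_eq (Finset.sum_congr rfl fun z _ => ?_))
    (sum_le_hasSum S (fun z _ => mul_nonneg (hK0 z) (sq_nonneg _)) (hasSum_carre hK F y))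
  rw [eval_apply, smul_apply, mulL_apply, sub_apply, shift_apply, sq]

/-- The solution of `∂v = -L v + carre (P_{T-τ} F)` with zero initial value. -/
noncomputable def accum (K : ℤ → ℝ) (T : ℝ) (F : SeqL1) (τ : ℝ) : SeqL1 :=
  semi K τ (∫ r in (0 : ℝ)..τ, semi K (-r) (carre K (semi K (T - r) F)))

theorem continuous_carre_semi_sub (T : ℝ) (F : SeqL1) :
    Continuous fun r => carre K (semi K (T - r) F) :=
  continuous_carre.comp
    ((continuous_semi.comp (continuous_const.sub continuous_id)).clm_apply continuous_const)

theorem continuous_accum_integrand (T : ℝ) (F : SeqL1) :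
    Continuous fun r => semi K (-r) (carre K (semi K (T - r) F)) :=
  (continuous_semi.comp continuous_neg).clm_apply (continuous_carre_semi_sub T F)

theorem accum_zero (T : ℝ) (F : SeqL1) : accum K T F 0 = 0 := by simp [accum]

theorem hasDerivAt_accum (T : ℝ) (F : SeqL1) (τ : ℝ) :
    HasDerivAt (accum K T F) (carre K (semi K (T - τ) F) - gen K (accum K T F τ)) τ := by
  have h1 := (continuous_accum_integrand (K := K) T F).integral_hasStrictDerivAt 0 τ
  have h2 := (hasDerivAt_semi' (K := K) τ).clm_apply h1.hasDerivAt
  refine h2.congr_deriv ?_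
  rw [neg_apply, mul_apply_eq_comp, neg_add_eq_sub,
    ← mul_apply_eq_comp (semi K τ), ← semi_add, add_neg_cancel, semi_zero]
  rfl

theorem accum_apply (T : ℝ) (F : SeqL1) (τ : ℝ) (x : ℤ) :
    accum K T F τ x = ∫ r in (0 : ℝ)..τ, semi K (τ - r) (carre K (semi K (T - r) F)) x := by
  have h := ((eval x).comp (semi K τ)).intervalIntegral_comp_comm
    ((continuous_accum_integrand (K := K) T F).intervalIntegrable (μ := volume) 0 τ)
  refine Eq.trans h.symm (intervalIntegral.integral_congr fun r _ => ?_)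
  simp only [ContinuousLinearMap.comp_apply, eval_apply]
  rw [← mul_apply_eq_comp (semi K τ), ← semi_add, sub_eq_add_neg τ]

theorem accum_nonneg (hK : Summable K) (hK0 : ∀ z, 0 ≤ K z) (T : ℝ) (F : SeqL1) {τ : ℝ}
    (hτ : 0 ≤ τ) (x : ℤ) : 0 ≤ accum K T F τ x := by
  rw [accum_apply]
  exact intervalIntegral.integral_nonneg hτ fun r hr =>
    semi_nonneg hK hK0 (sub_nonneg.mpr hr.2) (carre_nonneg hK hK0 _) x

theorem continuous_carre_semi_apply (F : SeqL1) (x : ℤ) :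
    Continuous fun t => carre K (semi K t F) x :=
  (eval x).continuous.comp (continuous_carre.comp (continuous_semi.clm_apply continuous_const))

theorem integral_carre_le_accum (hK : Summable K) (hK0 : ∀ z, 0 ≤ K z) {T : ℝ} (hT : 0 ≤ T)
    (F : SeqL1) (x : ℤ) :
    ∫ t in (0 : ℝ)..(2 * T), carre K (semi K t F) x ≤ 2 * accum K T F T x := by
  have h1 := intervalIntegral.integral_comp_sub_mul (a := 0) (b := T)
    (fun t => carre K (semi K t F) x) (two_ne_zero' ℝ) (2 * T)
  rw [sub_self, mul_zero, sub_zero, smul_eq_mul] at h1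
  have h2 : ∫ r in (0 : ℝ)..T, carre K (semi K (2 * T - 2 * r) F) x ≤ accum K T F T x := by
    rw [accum_apply]
    refine intervalIntegral.integral_mono_on hT
      (((continuous_carre_semi_apply F x).comp (by fun_prop)).intervalIntegrable _ _)
      (((eval x).continuous.comp ((continuous_semi.comp (by fun_prop)).clm_apply
        (continuous_carre_semi_sub T F))).intervalIntegrable _ _) fun r hr => ?_
    have e : 2 * T - 2 * r = (T - r) + (T - r) := by ring
    rw [e, semi_add]
    exact carre_semi_le hK hK0 (sub_nonneg.mpr hr.2) _ x
  rw [h1] at h2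
  linarith

/-- The involution `(x, z) ↦ (x + z, -z)` of `ℤ × ℤ`. -/
def swapEquiv : ℤ × ℤ ≃ ℤ × ℤ where
  toFun p := (p.1 + p.2, -p.2)
  invFun p := (p.1 + p.2, -p.2)
  left_inv p := by simp
  right_inv p := by simp

theorem tsum_symmetrized_nonneg (hK : Summable K) (hK0 : ∀ z, 0 ≤ K z) (hKe : ∀ z, K (-z) = K z)
    (w v : SeqL1) {a b : ℤ → ℝ} {M : ℝ} (ha : ∀ x, |a x| ≤ M) (hb : ∀ x, |b x| ≤ M)
    (hpair : ∀ x y, 0 ≤ (a x - a y) * (w x - w y) - (b x - b y) * (v x - v y) +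
      (b x + b y) * (w x - w y) ^ 2) :
    0 ≤ ∑' x, (a x * gen K w x + b x * (carre K w x - gen K v x)) := by
  set F : ℤ × ℤ → ℝ := fun p => K p.2 * (a p.1 * (w p.1 - w (p.1 + p.2)) +
    b p.1 * ((w p.1 - w (p.1 + p.2)) ^ 2 - (v p.1 - v (p.1 + p.2)))) with hF
  have hM : 0 ≤ M := (abs_nonneg _).trans (ha 0)
  have hG : Summable fun p : ℤ × ℤ => K p.2 * (|w p.1| + |v p.1|) :=
    ((w.summable_abs.add v.summable_abs).mul_of_nonneg hK
      (fun x => add_nonneg (abs_nonneg _) (abs_nonneg _)) hK0).congr fun p => mul_comm _ _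
  have hG' : Summable fun p : ℤ × ℤ => K p.2 * (|w (p.1 + p.2)| + |v (p.1 + p.2)|) := by
    refine (swapEquiv.summable_iff.mpr hG).congr fun p => ?_
    simp [swapEquiv, hKe]
  have hFs : Summable F := by
    refine Summable.of_norm_bounded ((hG.add hG').mul_left (M * (1 + 2 * ‖w‖))) fun p => ?_
    rw [Real.norm_eq_abs, hF]
    simp only
    generalize hx : p.1 = x
    generalize hz : p.2 = z
    have hw1 := w.abs_apply_le x
    have hw2 := w.abs_apply_le (x + z)
    have e1 : |w x - w (x + z)| ≤ |w x| + |w (x + z)| := abs_sub _ _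
    have e2 : |v x - v (x + z)| ≤ |v x| + |v (x + z)| := abs_sub _ _
    have e3 : |(w x - w (x + z)) ^ 2| ≤ 2 * ‖w‖ * (|w x| + |w (x + z)|) := by
      rw [abs_pow, sq]
      exact mul_le_mul (by linarith) e1 (abs_nonneg _) (by positivity)
    have e4 : |a x * (w x - w (x + z)) + b x * ((w x - w (x + z)) ^ 2 - (v x - v (x + z)))| ≤
        M * (|w x| + |w (x + z)|) +
          M * (2 * ‖w‖ * (|w x| + |w (x + z)|) + (|v x| + |v (x + z)|)) := by
      refine (abs_add_le _ _).trans ?_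
      rw [abs_mul, abs_mul]
      have := abs_sub ((w x - w (x + z)) ^ 2) (v x - v (x + z))
      gcongr
      · exact ha x
      · exact hb x
      · linarith
    rw [abs_mul, abs_of_nonneg (hK0 z)]
    have e5 : 0 ≤ M * ‖w‖ * (|v x| + |v (x + z)|) := by positivity
    calc _ ≤ K z * _ := mul_le_mul_of_nonneg_left e4 (hK0 z)
      _ ≤ K z * (M * (1 + 2 * ‖w‖) * ((|w x| + |v x|) + (|w (x + z)| + |v (x + z)|))) := by
        refine mul_le_mul_of_nonneg_left ?_ (hK0 z)
        nlinarith
      _ = _ := by ring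
  have hfib : HasSum (fun x => a x * gen K w x + b x * (carre K w x - gen K v x))
      (∑' p, F p) := by
    refine hFs.hasSum.prod_fiberwise fun x => ?_
    have h := ((hasSum_gen hK w x).mul_left (a x)).add
      (((hasSum_carre hK w x).sub (hasSum_gen hK v x)).mul_left (b x))
    refine h.congr_fun fun z => ?_
    simp only [hF]
    ring
  rw [hfib.tsum_eq]
  have hsw : ∑' p, F p = ∑' p, F (swapEquiv p) := (swapEquiv.tsum_eq F).symm
  have hadd : 0 ≤ ∑' p, (F p + F (swapEquiv p)) := by
    refine tsum_nonneg fun p => ?_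
    have e : F p + F (swapEquiv p) = K p.2 * ((a p.1 - a (p.1 + p.2)) * (w p.1 - w (p.1 + p.2)) -
        (b p.1 - b (p.1 + p.2)) * (v p.1 - v (p.1 + p.2)) +
        (b p.1 + b (p.1 + p.2)) * (w p.1 - w (p.1 + p.2)) ^ 2) := by
      simp only [hF, swapEquiv, Equiv.coe_fn_mk, hKe, add_neg_cancel_right]
      ring
    rw [e]
    exact mul_nonneg (hK0 _) (hpair _ _)
  have hFs' : Summable fun p => F (swapEquiv p) := swapEquiv.summable_iff.mpr hFs
  rw [hFs.tsum_add hFs', ← hsw] at hadd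
  linarith

theorem tsum_bellman_nonneg (hK : Summable K) (hK0 : ∀ z, 0 ≤ K z) (hKe : ∀ z, K (-z) = K z)
    {Φ A B : ℝ → ℝ → ℝ}
    (hΦ : ∀ (a b : ℝ → ℝ) (a' b' t : ℝ), HasDerivAt a a' t → HasDerivAt b b' t → 0 ≤ b t →
      HasDerivAt (fun t => Φ (a t) (b t)) (A (a t) (b t) * a' + B (a t) (b t) * b') t)
    (hA : ContinuousOn (fun p : ℝ × ℝ => A p.1 p.2) {p | 0 ≤ p.2})
    (hB : ContinuousOn (fun p : ℝ × ℝ => B p.1 p.2) {p | 0 ≤ p.2})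
    (hpair : ∀ w₁ w₂ v₁ v₂ : ℝ, 0 ≤ v₁ → 0 ≤ v₂ →
      0 ≤ (A w₁ v₁ - A w₂ v₂) * (w₁ - w₂) - (B w₁ v₁ - B w₂ v₂) * (v₁ - v₂) +
        (B w₁ v₁ + B w₂ v₂) * (w₁ - w₂) ^ 2)
    {T : ℝ} (hT : 0 ≤ T) (F : SeqL1) :
    (Summable fun x => Φ (F x) (accum K T F T x) - Φ (semi K T F x) 0) ∧
      0 ≤ ∑' x, (Φ (F x) (accum K T F T x) - Φ (semi K T F x) 0) := by
  set w : ℝ → SeqL1 := fun τ => semi K (T - τ) F with hw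
  set v : ℝ → SeqL1 := accum K T F with hv
  set w' : ℝ → SeqL1 := fun τ => gen K (w τ) with hw'
  set v' : ℝ → SeqL1 := fun τ => carre K (w τ) - gen K (v τ) with hv'
  have dw : ∀ τ, HasDerivAt w (w' τ) τ := fun τ => hasDerivAt_semi_sub T τ F
  have dv : ∀ τ, HasDerivAt v (v' τ) τ := fun τ => hasDerivAt_accum T F τ
  have cw : Continuous w := continuous_iff_continuousAt.mpr fun τ => (dw τ).continuousAt
  have cv : Continuous v := continuous_iff_continuousAt.mpr fun τ => (dv τ).continuousAt
  have cw' : Continuous w' := (gen K).continuous.comp cw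
  have cv' : Continuous v' := (continuous_carre.comp cw).sub ((gen K).continuous.comp cv)
  have hvnn : ∀ τ ∈ Set.Icc 0 T, ∀ x, 0 ≤ v τ x := fun τ hτ x =>
    accum_nonneg hK hK0 T F hτ.1 x
  obtain ⟨R₁, hR₁⟩ := isCompact_Icc.exists_bound_of_continuousOn (s := Set.Icc 0 T) cw.continuousOn
  obtain ⟨R₂, hR₂⟩ := isCompact_Icc.exists_bound_of_continuousOn (s := Set.Icc 0 T) cv.continuousOn
  obtain ⟨N₁, hN₁⟩ := isCompact_Icc.exists_bound_of_continuousOn (s := Set.Icc 0 T) cw'.continuousOn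
  obtain ⟨N₂, hN₂⟩ := isCompact_Icc.exists_bound_of_continuousOn (s := Set.Icc 0 T) cv'.continuousOn
  have hbox : IsCompact (Set.Icc (-R₁) R₁ ×ˢ Set.Icc 0 R₂ : Set (ℝ × ℝ)) :=
    isCompact_Icc.prod isCompact_Icc
  have hsub : (Set.Icc (-R₁) R₁ ×ˢ Set.Icc 0 R₂ : Set (ℝ × ℝ)) ⊆ {p | 0 ≤ p.2} :=
    fun p hp => hp.2.1
  obtain ⟨M₁, hM₁⟩ := hbox.exists_bound_of_continuousOn (hA.mono hsub)
  obtain ⟨M₂, hM₂⟩ := hbox.exists_bound_of_continuousOn (hB.mono hsub)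
  have hmem : ∀ τ ∈ Set.Icc 0 T, ∀ x,
      (w τ x, v τ x) ∈ (Set.Icc (-R₁) R₁ ×ˢ Set.Icc 0 R₂ : Set (ℝ × ℝ)) := fun τ hτ x =>
    ⟨abs_le.mp (((w τ).abs_apply_le x).trans (hR₁ τ hτ)),
      hvnn τ hτ x, (le_abs_self _).trans (((v τ).abs_apply_le x).trans (hR₂ τ hτ))⟩
  set M : ℝ := max M₁ M₂ with hM
  have hAM : ∀ τ ∈ Set.Icc 0 T, ∀ x, |A (w τ x) (v τ x)| ≤ M := fun τ hτ x =>
    (hM₁ _ (hmem τ hτ x)).trans (le_max_left _ _)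
  have hBM : ∀ τ ∈ Set.Icc 0 T, ∀ x, |B (w τ x) (v τ x)| ≤ M := fun τ hτ x =>
    (hM₂ _ (hmem τ hτ x)).trans (le_max_right _ _)
  have hM0 : 0 ≤ M := (abs_nonneg _).trans (hAM 0 ⟨le_rfl, hT⟩ 0)
  set h : ℤ → ℝ → ℝ := fun x τ =>
    A (w τ x) (v τ x) * w' τ x + B (w τ x) (v τ x) * v' τ x with hh
  have hev : ∀ {u : ℝ → SeqL1}, Continuous u → ∀ x, Continuous fun τ => u τ x :=
    fun hu x => (eval x).continuous.comp hu
  have hmap : ∀ x, Set.MapsTo (fun τ => (w τ x, v τ x)) (Set.Icc 0 T) {p : ℝ × ℝ | 0 ≤ p.2} :=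
    fun x τ hτ => hvnn τ hτ x
  have ch : ∀ x, ContinuousOn (h x) (Set.Icc 0 T) := fun x =>
    ((hA.comp ((hev cw x).prodMk (hev cv x)).continuousOn (hmap x)).mul
      (hev cw' x).continuousOn).add
    ((hB.comp ((hev cw x).prodMk (hev cv x)).continuousOn (hmap x)).mul
      (hev cv' x).continuousOn)
  have hint : ∀ x, IntegrableOn (h x) (Set.Ioc 0 T) := fun x =>
    ((ch x).integrableOn_Icc).mono_set Set.Ioc_subset_Icc_self
  have hbound : ∀ S : Finset ℤ, ∑ x ∈ S, ∫ τ in Set.Ioc 0 T, ‖h x τ‖ ≤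
      M * (N₁ + N₂) * T := by
    intro S
    rw [← integral_finsetSum _ fun x _ => (hint x).norm]
    have hle : ∀ τ ∈ Set.Ioc 0 T, ∑ x ∈ S, ‖h x τ‖ ≤ M * (N₁ + N₂) := by
      intro τ hτ
      have hτ' := Set.Ioc_subset_Icc_self hτ
      calc ∑ x ∈ S, ‖h x τ‖ ≤ ∑ x ∈ S, M * (|w' τ x| + |v' τ x|) := by
            refine Finset.sum_le_sum fun x _ => ?_
            rw [Real.norm_eq_abs, mul_add]
            refine (abs_add_le _ _).trans ?_
            rw [abs_mul, abs_mul]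
            gcongr
            · exact hAM τ hτ' x
            · exact hBM τ hτ' x
        _ = M * (∑ x ∈ S, |w' τ x| + ∑ x ∈ S, |v' τ x|) := by
            rw [← Finset.mul_sum, Finset.sum_add_distrib]
        _ ≤ M * (N₁ + N₂) := by
            gcongr
            · exact ((w' τ).sum_abs_le S).trans (hN₁ τ hτ')
            · exact ((v' τ).sum_abs_le S).trans (hN₂ τ hτ')
    refine (setIntegral_mono_on (integrable_finsetSum _ fun x _ => (hint x).norm)
      (integrableOn_const (by simp)) measurableSet_Ioc hle).trans ?_
    simp [hT, mul_comm]
  have hsum := hasSum_integral_of_summable_integral_norm (F := h)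
    (μ := volume.restrict (Set.Ioc 0 T)) hint
    (summable_of_sum_le (fun x => integral_nonneg fun τ => norm_nonneg _) hbound)
  have hftc : ∀ x, ∫ τ in Set.Ioc 0 T, h x τ =
      Φ (F x) (accum K T F T x) - Φ (semi K T F x) 0 := by
    intro x
    rw [← intervalIntegral.integral_of_le hT,
      intervalIntegral.integral_eq_sub_of_hasDerivAt (f := fun τ => Φ (w τ x) (v τ x))]
    · simp only [hw, hv, sub_self, sub_zero, semi_zero, accum_zero]
      rfl
    · intro τ hτ
      rw [Set.uIcc_of_le hT] at hτ
      exact hΦ _ _ _ _ τ ((eval x).hasFDerivAt.comp_hasDerivAt τ (dw τ))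
        ((eval x).hasFDerivAt.comp_hasDerivAt τ (dv τ)) (hvnn τ hτ x)
    · exact (intervalIntegrable_iff_integrableOn_Ioc_of_le hT).mpr (hint x)
  simp_rw [hftc] at hsum
  refine ⟨hsum.summable, hsum.tsum_eq ▸ setIntegral_nonneg measurableSet_Ioc fun τ hτ => ?_⟩
  have hτ' := Set.Ioc_subset_Icc_self hτ
  exact tsum_symmetrized_nonneg hK hK0 hKe (w τ) (v τ) (hAM τ hτ') (hBM τ hτ')
    fun x y => hpair _ _ _ _ (hvnn τ hτ' x) (hvnn τ hτ' y)

theorem rpow_eq_mul_rpow_sub_one {x p : ℝ} (hx : 0 ≤ x) (hp : 1 ≤ p) :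
    x ^ p = x * x ^ (p - 1) := by
  have h := Real.rpow_add_of_nonneg hx zero_le_one (sub_nonneg.mpr hp)
  rwa [Real.rpow_one, add_sub_cancel] at h

theorem mul_rpow_sub_one_le {p a b : ℝ} (hp : 1 ≤ p) (ha : 0 ≤ a) (hb : 0 ≤ b) :
    p * a * b ^ (p - 1) ≤ b ^ p / 2 + p * (2 * p) ^ (p - 1) * a ^ p := by
  have h1 : 0 ≤ b ^ (p - 1) := by positivity
  have h2 : 0 ≤ p * (2 * p) ^ (p - 1) * a ^ p := by positivity
  have h3 : 0 ≤ b ^ p / 2 := by positivity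
  rcases le_total (2 * p * a) b with h | h
  · have : p * a * b ^ (p - 1) ≤ b ^ p / 2 := by
      rw [rpow_eq_mul_rpow_sub_one hb hp]
      nlinarith
    linarith
  · have h4 : b ^ (p - 1) ≤ (2 * p) ^ (p - 1) * a ^ (p - 1) := by
      rw [← Real.mul_rpow (by positivity) ha]
      exact Real.rpow_le_rpow hb h (by linarith)
    have : p * a * b ^ (p - 1) ≤ p * (2 * p) ^ (p - 1) * a ^ p := by
      rw [rpow_eq_mul_rpow_sub_one ha hp]
      calc p * a * b ^ (p - 1) ≤ p * a * ((2 * p) ^ (p - 1) * a ^ (p - 1)) := by gcongr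
        _ = _ := by ring
    linarith

theorem mul_rpow_sub_two_mul_le {p a b M : ℝ} (hp : 2 ≤ p) (ha : 0 ≤ a) (hb : 0 ≤ b)
    (hM : 0 ≤ M) : M * b ^ (p - 2) * a ≤ b ^ (p - 1) + M ^ (p - 1) * a ^ (p - 1) := by
  have e : p - 2 = p - 1 - 1 := by ring
  have hp1 : 1 ≤ p - 1 := by linarith
  have h1 : 0 ≤ b ^ (p - 2) := by positivity
  have h2 : 0 ≤ b ^ (p - 1) := by positivity
  have h3 : 0 ≤ (M * a) ^ (p - 1) := by positivity
  rw [← Real.mul_rpow hM ha]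
  rcases le_total (M * a) b with h | h
  · have : M * b ^ (p - 2) * a ≤ b ^ (p - 1) := by
      rw [rpow_eq_mul_rpow_sub_one hb hp1, ← e]
      nlinarith
    linarith
  · have h4 : b ^ (p - 2) ≤ (M * a) ^ (p - 2) := Real.rpow_le_rpow hb h (by linarith)
    have : M * b ^ (p - 2) * a ≤ (M * a) ^ (p - 1) := by
      rw [rpow_eq_mul_rpow_sub_one (mul_nonneg hM ha) hp1, ← e]
      calc M * b ^ (p - 2) * a = M * a * b ^ (p - 2) := by ring
        _ ≤ _ := by gcongr
    linarith

theorem add_rpow_le {p a b : ℝ} (hp : 0 ≤ p) (ha : 0 ≤ a) (hb : 0 ≤ b) :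
    (a + b) ^ p ≤ 2 ^ p * (a ^ p + b ^ p) := by
  have h1 : 0 ≤ a ^ p := by positivity
  have h2 : 0 ≤ b ^ p := by positivity
  have h3 : (0 : ℝ) ≤ 2 ^ p := by positivity
  rcases le_total a b with h | h
  · calc (a + b) ^ p ≤ (2 * b) ^ p := Real.rpow_le_rpow (by positivity) (by linarith) hp
      _ = 2 ^ p * b ^ p := Real.mul_rpow (by norm_num) hb
      _ ≤ _ := by gcongr; linarith
  · calc (a + b) ^ p ≤ (2 * a) ^ p := Real.rpow_le_rpow (by positivity) (by linarith) hp
      _ = 2 ^ p * a ^ p := Real.mul_rpow (by norm_num) ha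
      _ ≤ _ := by gcongr; linarith

theorem rpow_le_tangent {r x y : ℝ} (hr0 : 0 ≤ r) (hr1 : r ≤ 1) (hx : 0 < x) (hy : 0 < y) :
    x ^ r ≤ y ^ r + r * y ^ (r - 1) * (x - y) := by
  have h := rpow_one_add_le_one_add_mul_self (s := x / y - 1)
    (by linarith [div_pos hx hy]) hr0 hr1
  rw [add_sub_cancel, Real.div_rpow hx.le hy.le, div_le_iff₀ (by positivity)] at h
  refine h.trans (le_of_eq ?_)
  rw [Real.rpow_sub_one hy.ne']
  field_simp

theorem tangent_le_rpow {r x y : ℝ} (hr : 1 ≤ r) (hx : 0 ≤ x) (hy : 0 ≤ y) :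
    y ^ r + r * y ^ (r - 1) * (x - y) ≤ x ^ r := by
  rcases hy.eq_or_lt with rfl | hy
  · rcases hr.eq_or_lt with rfl | hr
    · simp
    · rw [Real.zero_rpow (by linarith), Real.zero_rpow (by linarith)]
      simpa using Real.rpow_nonneg hx r
  have h := one_add_mul_self_le_rpow_one_add (s := x / y - 1)
    (by linarith [div_nonneg hx hy.le]) hr
  rw [add_sub_cancel, Real.div_rpow hx hy.le, le_div_iff₀ (by positivity)] at h
  refine le_trans (le_of_eq ?_) h
  rw [Real.rpow_sub_one hy.ne']
  field_simp

theorem hasDerivAt_max_zero_rpow {p : ℝ} (hp : 1 < p) (x : ℝ) :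
    HasDerivAt (fun x : ℝ => max x 0 ^ p) (p * max x 0 ^ (p - 1)) x := by
  rcases lt_trichotomy x 0 with hx | rfl | hx
  · rw [max_eq_right hx.le, Real.zero_rpow (by linarith), mul_zero]
    refine (hasDerivAt_const x (0 : ℝ)).congr_of_eventuallyEq ?_
    filter_upwards [eventually_lt_nhds hx] with y hy
    rw [max_eq_right hy.le, Real.zero_rpow (by linarith)]
  · rw [max_self, Real.zero_rpow (by linarith), mul_zero]
    have h := hasDerivAt_abs_rpow 0 hp
    rw [mul_zero, hasDerivAt_iff_isLittleO] at h
    rw [hasDerivAt_iff_isLittleO]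
    refine Asymptotics.IsBigO.trans_isLittleO (Asymptotics.IsBigO.of_bound 1 ?_) h
    refine Filter.Eventually.of_forall fun y => ?_
    have e : (0 : ℝ) ^ p = 0 := Real.zero_rpow (by linarith)
    simp only [max_self, abs_zero, e, sub_zero, smul_zero, one_mul, Real.norm_eq_abs]
    exact abs_le_abs_of_nonneg (by positivity)
      (Real.rpow_le_rpow (le_max_right _ _) (max_le (le_abs_self _) (abs_nonneg _)) (by linarith))
  · rw [max_eq_left hx.le]
    refine (Real.hasDerivAt_rpow_const (Or.inl hx.ne')).congr_of_eventuallyEq ?_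
    filter_upwards [eventually_gt_nhds hx] with y hy
    rw [max_eq_left hy.le]

theorem summable_rpow {p : ℝ} (hp : 1 ≤ p) (V : SeqL1) (hV : ∀ x, 0 ≤ V x) :
    Summable fun x => V x ^ p := by
  refine Summable.of_nonneg_of_le (fun x => Real.rpow_nonneg (hV x) p) (fun x => ?_)
    (V.summable.mul_right (‖V‖ ^ (p - 1)))
  rw [rpow_eq_mul_rpow_sub_one (hV x) hp]
  exact mul_le_mul_of_nonneg_left (Real.rpow_le_rpow (hV x)
    ((le_abs_self _).trans (V.abs_apply_le x)) (by linarith)) (hV x)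

theorem summable_sq (F : SeqL1) : Summable fun x => F x ^ 2 :=
  (mulL F F).summable.congr fun x => (sq (F x)).symm

theorem summable_sq_rpow {p : ℝ} (hp : 1 ≤ p) (F : SeqL1) : Summable fun x => (F x ^ 2) ^ p :=
  (summable_rpow hp (mk _ F.summable_sq) fun x => sq_nonneg (F x)).congr fun _ => rfl

theorem sum_le_tsum_sub_of_le {D E G : ℤ → ℝ} (hD : Summable D) (hE : Summable E)
    (hD0 : 0 ≤ ∑' x, D x) (hG : ∀ x, 0 ≤ G x) (h : ∀ x, G x ≤ E x - D x) (S : Finset ℤ) :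
    ∑ x ∈ S, G x ≤ ∑' x, E x := by
  have h1 := (hE.sub hD).sum_le_tsum S fun x _ => (hG x).trans (h x)
  rw [hE.tsum_sub hD] at h1
  linarith [Finset.sum_le_sum fun x (_ : x ∈ S) => h x]

theorem bellman_pair_of_le_two {p ε w₁ w₂ v₁ v₂ : ℝ} (hp1 : 1 ≤ p) (hp2 : p ≤ 2) (hε : 0 < ε)
    (hv₁ : 0 ≤ v₁) (hv₂ : 0 ≤ v₂) :
    0 ≤ (p * (2 * w₁ * (v₁ + ε) ^ (p - 1)) - p * (2 * w₂ * (v₂ + ε) ^ (p - 1))) * (w₁ - w₂) -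
      ((p * (w₁ ^ 2 * ((p - 1) * (v₁ + ε) ^ (p - 1 - 1)) - (v₁ + ε) ^ (p - 1))) -
        (p * (w₂ ^ 2 * ((p - 1) * (v₂ + ε) ^ (p - 1 - 1)) - (v₂ + ε) ^ (p - 1)))) * (v₁ - v₂) +
      ((p * (w₁ ^ 2 * ((p - 1) * (v₁ + ε) ^ (p - 1 - 1)) - (v₁ + ε) ^ (p - 1))) +
        (p * (w₂ ^ 2 * ((p - 1) * (v₂ + ε) ^ (p - 1 - 1)) - (v₂ + ε) ^ (p - 1)))) *
          (w₁ - w₂) ^ 2 := by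
  have y1 : 0 < v₁ + ε := by linarith
  have y2 : 0 < v₂ + ε := by linarith
  have hr0 : 0 ≤ p - 1 := by linarith
  have t1 := rpow_le_tangent (r := p - 1) hr0 (by linarith) y1 y2
  have t2 := rpow_le_tangent (r := p - 1) hr0 (by linarith) y2 y1
  have hmono : 0 ≤ ((v₁ + ε) ^ (p - 1) - (v₂ + ε) ^ (p - 1)) * (v₁ - v₂) := by
    rcases le_total v₁ v₂ with h | h
    · exact mul_nonneg_of_nonpos_of_nonpos
        (sub_nonpos.mpr (Real.rpow_le_rpow y1.le (by linarith) hr0)) (by linarith)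
    · exact mul_nonneg (sub_nonneg.mpr (Real.rpow_le_rpow y2.le (by linarith) hr0)) (by linarith)
  have d1 : 0 ≤ (p - 1) * (v₁ + ε) ^ (p - 1 - 1) := by positivity
  have d2 : 0 ≤ (p - 1) * (v₂ + ε) ^ (p - 1 - 1) := by positivity
  generalize (p - 1) * (v₁ + ε) ^ (p - 1 - 1) = δ₁ at *
  generalize (p - 1) * (v₂ + ε) ^ (p - 1 - 1) = δ₂ at *
  generalize (v₁ + ε) ^ (p - 1) = θ₁ at *
  generalize (v₂ + ε) ^ (p - 1) = θ₂ at *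
  have q1 : 0 ≤ w₁ ^ 2 * (θ₁ - θ₂ - δ₁ * (v₁ - v₂)) := mul_nonneg (sq_nonneg _) (by linarith)
  have q2 : 0 ≤ w₂ ^ 2 * (θ₂ + δ₂ * (v₁ - v₂) - θ₁) := mul_nonneg (sq_nonneg _) (by linarith)
  have q3 : 0 ≤ (w₁ ^ 2 * δ₁ + w₂ ^ 2 * δ₂) * (w₁ - w₂) ^ 2 := by positivity
  have key := mul_nonneg (by linarith : (0 : ℝ) ≤ p) (add_nonneg (add_nonneg q1 q2)
    (add_nonneg q3 hmono))
  refine key.trans (le_of_eq ?_)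
  ring

theorem sum_accum_add_rpow_sub_le (hK : Summable K) (hK0 : ∀ z, 0 ≤ K z)
    (hKe : ∀ z, K (-z) = K z) {p ε : ℝ} (hp1 : 1 ≤ p) (hp2 : p ≤ 2) (hε : 0 < ε) {T : ℝ}
    (hT : 0 ≤ T) (F : SeqL1) (S : Finset ℤ) :
    ∑ x ∈ S, ((accum K T F T x + ε) ^ p - ε ^ p) ≤
      ∑' x, p * F x ^ 2 * (accum K T F T x + ε) ^ (p - 1) := by
  have hv : ∀ x, 0 ≤ accum K T F T x := accum_nonneg hK hK0 T F hT
  have hr0 : 0 ≤ p - 1 := by linarith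
  have hcont : ∀ r : ℝ, ContinuousOn (fun q : ℝ × ℝ => (q.2 + ε) ^ r) {q | 0 ≤ q.2} := fun r =>
    ContinuousOn.rpow_const (by fun_prop) fun q hq => Or.inl (by
      have : (0 : ℝ) ≤ q.2 := hq
      linarith)
  obtain ⟨hD, hD0⟩ := tsum_bellman_nonneg hK hK0 hKe
    (Φ := fun w v => p * (w ^ 2 * (v + ε) ^ (p - 1)) - (v + ε) ^ p)
    (A := fun w v => p * (2 * w * (v + ε) ^ (p - 1)))
    (B := fun w v => p * (w ^ 2 * ((p - 1) * (v + ε) ^ (p - 1 - 1)) - (v + ε) ^ (p - 1)))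
    (by
      intro a b a' b' t ha hb ht
      have hne : b t + ε ≠ 0 := by linarith
      have h1 := (hb.add_const ε).rpow_const (p := p - 1) (Or.inl hne)
      have h2 := (hb.add_const ε).rpow_const (p := p) (Or.inl hne)
      refine ((((ha.pow 2).mul h1).const_mul p).sub h2).congr_deriv ?_
      simp only [Pi.pow_apply]
      ring)
    (by
      have := hcont (p - 1)
      fun_prop)
    (by
      have := hcont (p - 1)
      have := hcont (p - 1 - 1)
      fun_prop)
    (fun w₁ w₂ v₁ v₂ h₁ h₂ => bellman_pair_of_le_two hp1 hp2 hε h₁ h₂) hT F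
  refine sum_le_tsum_sub_of_le hD ?_ hD0 (fun x => ?_) (fun x => ?_) S
  · refine Summable.of_nonneg_of_le (fun x => ?_) (fun x => ?_)
      (F.summable_sq.mul_left (p * (‖accum K T F T‖ + ε) ^ (p - 1)))
    · have := hv x
      positivity
    · have h := Real.rpow_le_rpow (by linarith [hv x]) (add_le_add_left
        ((le_abs_self _).trans ((accum K T F T).abs_apply_le x)) ε) hr0
      calc _ ≤ p * F x ^ 2 * (‖accum K T F T‖ + ε) ^ (p - 1) := by gcongr
        _ = _ := by ring
  · exact sub_nonneg.mpr (Real.rpow_le_rpow hε.le (by linarith [hv x]) (by linarith))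
  · have : 0 ≤ p * (semi K T F x ^ 2 * (0 + ε) ^ (p - 1)) := by
      rw [zero_add]; positivity
    rw [zero_add] at *
    linarith

theorem sum_accum_rpow_le_of_le_two (hK : Summable K) (hK0 : ∀ z, 0 ≤ K z)
    (hKe : ∀ z, K (-z) = K z) {p : ℝ} (hp1 : 1 ≤ p) (hp2 : p ≤ 2) {T : ℝ}
    (hT : 0 ≤ T) (F : SeqL1) (S : Finset ℤ) :
    ∑ x ∈ S, accum K T F T x ^ p ≤ ∑' x, p * F x ^ 2 * accum K T F T x ^ (p - 1) := by
  have hv : ∀ x, 0 ≤ accum K T F T x := accum_nonneg hK hK0 T F hT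
  have hr0 : 0 ≤ p - 1 := by linarith
  have hlim : ∀ {r : ℝ}, 0 ≤ r → ∀ y : ℝ, Filter.Tendsto (fun ε : ℝ => (y + ε) ^ r)
      (nhdsWithin 0 (Set.Ioi 0)) (nhds (y ^ r)) := by
    intro r hr y
    have hc : Continuous fun ε : ℝ => (y + ε) ^ r :=
      (Real.continuous_rpow_const hr).comp (continuous_const.add continuous_id)
    simpa using (hc.tendsto 0).mono_left nhdsWithin_le_nhds
  refine le_of_tendsto_of_tendsto (b := nhdsWithin (0 : ℝ) (Set.Ioi 0))
    (f := fun ε => ∑ x ∈ S, ((accum K T F T x + ε) ^ p - ε ^ p))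
    (g := fun ε => ∑' x, p * F x ^ 2 * (accum K T F T x + ε) ^ (p - 1)) ?_ ?_ ?_
  · refine tendsto_finsetSum _ fun x _ => ?_
    have h := (hlim (by linarith : 0 ≤ p) (accum K T F T x)).sub (hlim (by linarith : 0 ≤ p) 0)
    simpa [Real.zero_rpow (by linarith : p ≠ 0)] using h
  · refine tendsto_tsum_of_dominated_convergence
      (bound := fun x => p * (‖accum K T F T‖ + 1) ^ (p - 1) * F x ^ 2)
      (F.summable_sq.mul_left _) (fun x => (hlim hr0 _).const_mul _) ?_
    filter_upwards [Ioc_mem_nhdsGT (zero_lt_one' ℝ)] with ε hε x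
    have h := Real.rpow_le_rpow (by linarith [hv x, hε.1]) (add_le_add
        ((le_abs_self _).trans ((accum K T F T).abs_apply_le x)) hε.2) hr0
    have h0 : 0 ≤ (accum K T F T x + ε) ^ (p - 1) :=
      Real.rpow_nonneg (by linarith [hv x, hε.1]) _
    rw [Real.norm_eq_abs, abs_of_nonneg (by positivity)]
    calc _ ≤ p * F x ^ 2 * (‖accum K T F T‖ + 1) ^ (p - 1) := by gcongr
      _ = _ := by ring
  · filter_upwards [self_mem_nhdsWithin] with ε hε
    exact sum_accum_add_rpow_sub_le hK hK0 hKe hp1 hp2 hε hT F S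

theorem sum_accum_rpow_le_small (hK : Summable K) (hK0 : ∀ z, 0 ≤ K z)
    (hKe : ∀ z, K (-z) = K z) {p : ℝ} (hp1 : 1 ≤ p) (hp2 : p ≤ 2) {T : ℝ}
    (hT : 0 ≤ T) (F : SeqL1) (S : Finset ℤ) :
    ∑ x ∈ S, accum K T F T x ^ p ≤ 2 * (p * (2 * p) ^ (p - 1)) * ∑' x, (F x ^ 2) ^ p := by
  have hv : ∀ x, 0 ≤ accum K T F T x := accum_nonneg hK hK0 T F hT
  have hs1 : Summable fun x => accum K T F T x ^ p := summable_rpow hp1 _ hv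
  have hs2 := (summable_sq_rpow hp1 F).mul_left (p * (2 * p) ^ (p - 1))
  have hs3 := (hs1.div_const 2).add hs2
  have hyoung := fun x => mul_rpow_sub_one_le hp1 (sq_nonneg (F x)) (hv x)
  have hnn : ∀ x, 0 ≤ p * F x ^ 2 * accum K T F T x ^ (p - 1) := fun x =>
    mul_nonneg (by positivity) (Real.rpow_nonneg (hv x) _)
  have h1 : ∑' x, accum K T F T x ^ p ≤ ∑' x, p * F x ^ 2 * accum K T F T x ^ (p - 1) :=
    hs1.tsum_le_of_sum_le fun S => sum_accum_rpow_le_of_le_two hK hK0 hKe hp1 hp2 hT F S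
  have h2 := (Summable.of_nonneg_of_le hnn hyoung hs3).tsum_le_tsum hyoung hs3
  rw [(hs1.div_const 2).tsum_add hs2, tsum_div_const, tsum_mul_left] at h2
  have h3 := hs1.sum_le_tsum S fun x _ => Real.rpow_nonneg (hv x) p
  linarith

theorem bellman_pair_aux {p w₁ w₂ j₁ j₂ : ℝ} (hp : 2 ≤ p) (hj : j₂ ≤ j₁) :
    0 ≤ ((16 * (p - 1)) ^ (p - 1) * ((w₁ ^ 2) ^ (p - 1) + (w₂ ^ 2) ^ (p - 1)) +
        (max j₁ 0 ^ (p - 1) + max j₂ 0 ^ (p - 1))) * (w₁ - w₂) ^ 2 +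
      (16 * (p - 1)) ^ (p - 1) * (((w₁ ^ 2) ^ (p - 1) - (w₂ ^ 2) ^ (p - 1)) *
        (w₁ ^ 2 - w₂ ^ 2)) +
      (max j₁ 0 ^ (p - 1) - max j₂ 0 ^ (p - 1)) * ((j₁ - j₂) + 4 * (w₁ ^ 2 - w₂ ^ 2)) := by
  have hr1 : 1 ≤ p - 1 := by linarith
  have hM : 0 ≤ 16 * (p - 1) := by linarith
  have hk1 : 0 ≤ max j₁ 0 := le_max_right _ _
  have hk2 : 0 ≤ max j₂ 0 := le_max_right _ _
  have hk : max j₂ 0 ≤ max j₁ 0 := max_le_max_right 0 hj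
  have hkj : max j₁ 0 - max j₂ 0 ≤ j₁ - j₂ := by
    rcases le_total j₁ 0 with h | h
    · rw [max_eq_right h, max_eq_right (hj.trans h)]; linarith
    · rw [max_eq_left h]; linarith [le_max_left j₂ 0]
  have hκ : max j₂ 0 ^ (p - 1) ≤ max j₁ 0 ^ (p - 1) := Real.rpow_le_rpow hk2 hk (by linarith)
  have hκ2 : 0 ≤ max j₂ 0 ^ (p - 1) := Real.rpow_nonneg hk2 _
  have htan := tangent_le_rpow hr1 hk2 hk1
  have e : p - 1 - 1 = p - 2 := by ring
  rw [e] at htan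
  have ha1 : w₁ ^ 2 ≤ max (w₁ ^ 2) (w₂ ^ 2) := le_max_left _ _
  have ha2 : w₂ ^ 2 ≤ max (w₁ ^ 2) (w₂ ^ 2) := le_max_right _ _
  have hyoung := mul_rpow_sub_two_mul_le hp ((sq_nonneg w₁).trans ha1) hk1 hM
  have hc1 : 0 ≤ (w₁ ^ 2) ^ (p - 1) := by positivity
  have hc2 : 0 ≤ (w₂ ^ 2) ^ (p - 1) := by positivity
  have hac : max (w₁ ^ 2) (w₂ ^ 2) ^ (p - 1) ≤ (w₁ ^ 2) ^ (p - 1) + (w₂ ^ 2) ^ (p - 1) := by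
    rcases le_total (w₁ ^ 2) (w₂ ^ 2) with h | h
    · rw [max_eq_right h]; linarith
    · rw [max_eq_left h]; linarith
  have hcX : 0 ≤ ((w₁ ^ 2) ^ (p - 1) - (w₂ ^ 2) ^ (p - 1)) * (w₁ ^ 2 - w₂ ^ 2) := by
    rcases le_total (w₁ ^ 2) (w₂ ^ 2) with h | h
    · exact mul_nonneg_of_nonpos_of_nonpos
        (sub_nonpos.mpr (Real.rpow_le_rpow (sq_nonneg _) h (by linarith))) (by linarith)
    · exact mul_nonneg
        (sub_nonneg.mpr (Real.rpow_le_rpow (sq_nonneg _) h (by linarith))) (by linarith)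
  have hC : 0 ≤ (16 * (p - 1)) ^ (p - 1) := Real.rpow_nonneg hM _
  have hm : 0 ≤ (p - 1) * max j₁ 0 ^ (p - 2) := by positivity
  have hyoung' : 16 * ((p - 1) * max j₁ 0 ^ (p - 2)) * max (w₁ ^ 2) (w₂ ^ 2) ≤
      max j₁ 0 ^ (p - 1) + (16 * (p - 1)) ^ (p - 1) * max (w₁ ^ 2) (w₂ ^ 2) ^ (p - 1) :=
    le_trans (le_of_eq (by ring)) hyoung
  generalize max j₁ 0 ^ (p - 1) = κ₁ at *
  generalize max j₂ 0 ^ (p - 1) = κ₂ at *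
  generalize (p - 1) * max j₁ 0 ^ (p - 2) = m at *
  generalize (16 * (p - 1)) ^ (p - 1) = C at *
  generalize (w₁ ^ 2) ^ (p - 1) = c₁ at *
  generalize (w₂ ^ 2) ^ (p - 1) = c₂ at *
  have h8 : 8 * m * (w₁ ^ 2 + w₂ ^ 2) ≤ κ₁ + C * (c₁ + c₂) := by
    have := mul_le_mul_of_nonneg_left hac hC
    have := mul_le_mul_of_nonneg_left (add_le_add ha1 ha2) hm
    linarith
  have hX : 4 * m * (w₁ ^ 2 - w₂ ^ 2) ^ 2 ≤ (κ₁ + C * (c₁ + c₂)) * (w₁ - w₂) ^ 2 := by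
    have h1 := mul_le_mul_of_nonneg_right h8 (sq_nonneg (w₁ - w₂))
    have h2 : 0 ≤ 4 * m * (w₁ - w₂) ^ 2 * (w₁ - w₂) ^ 2 := by positivity
    refine le_trans ?_ h1
    linarith [show 8 * m * (w₁ ^ 2 + w₂ ^ 2) * (w₁ - w₂) ^ 2 - 4 * m * (w₁ ^ 2 - w₂ ^ 2) ^ 2 =
      4 * m * (w₁ - w₂) ^ 2 * (w₁ - w₂) ^ 2 by ring]
  have hκj : κ₁ - κ₂ ≤ m * (j₁ - j₂) := by
    have := mul_le_mul_of_nonneg_left hkj hm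
    linarith
  have hlow : -(4 * m * (w₁ ^ 2 - w₂ ^ 2) ^ 2) ≤
      (κ₁ - κ₂) * ((j₁ - j₂) + 4 * (w₁ ^ 2 - w₂ ^ 2)) := by
    rcases le_total 0 ((j₁ - j₂) + 4 * (w₁ ^ 2 - w₂ ^ 2)) with h | h
    · have h1 := mul_nonneg (sub_nonneg.mpr hκ) h
      have h2 : 0 ≤ 4 * m * (w₁ ^ 2 - w₂ ^ 2) ^ 2 := by positivity
      linarith
    · have h1 := mul_le_mul_of_nonpos_right hκj h
      have h2 : 0 ≤ m * ((j₁ - j₂) + 2 * (w₁ ^ 2 - w₂ ^ 2)) ^ 2 := by positivity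
      linarith
  have h3 : 0 ≤ κ₂ * (w₁ - w₂) ^ 2 := by positivity
  have h4 := mul_nonneg hC hcX
  linarith

theorem bellman_pair_of_two_le {p w₁ w₂ v₁ v₂ : ℝ} (hp : 2 ≤ p) :
    0 ≤ (p * ((16 * (p - 1)) ^ (p - 1) * ((w₁ ^ 2) ^ (p - 1) * (2 * w₁)) +
          max (v₁ - 2 * w₁ ^ 2) 0 ^ (p - 1) * (4 * w₁)) -
        p * ((16 * (p - 1)) ^ (p - 1) * ((w₂ ^ 2) ^ (p - 1) * (2 * w₂)) +
          max (v₂ - 2 * w₂ ^ 2) 0 ^ (p - 1) * (4 * w₂))) * (w₁ - w₂) -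
      (-(p * max (v₁ - 2 * w₁ ^ 2) 0 ^ (p - 1)) - -(p * max (v₂ - 2 * w₂ ^ 2) 0 ^ (p - 1))) *
        (v₁ - v₂) +
      (-(p * max (v₁ - 2 * w₁ ^ 2) 0 ^ (p - 1)) + -(p * max (v₂ - 2 * w₂ ^ 2) 0 ^ (p - 1))) *
        (w₁ - w₂) ^ 2 := by
  have hp0 : 0 ≤ p := by linarith
  rcases le_total (v₂ - 2 * w₂ ^ 2) (v₁ - 2 * w₁ ^ 2) with h | h
  · refine (mul_nonneg hp0 (bellman_pair_aux (w₁ := w₁) (w₂ := w₂) hp h)).trans (le_of_eq ?_)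
    ring
  · refine (mul_nonneg hp0 (bellman_pair_aux (w₁ := w₂) (w₂ := w₁) hp h)).trans (le_of_eq ?_)
    ring

theorem sum_max_rpow_le (hK : Summable K) (hK0 : ∀ z, 0 ≤ K z)
    (hKe : ∀ z, K (-z) = K z) {p : ℝ} (hp : 2 ≤ p) {T : ℝ} (hT : 0 ≤ T) (F : SeqL1)
    (S : Finset ℤ) :
    ∑ x ∈ S, max (accum K T F T x - 2 * F x ^ 2) 0 ^ p ≤
      ∑' x, (16 * (p - 1)) ^ (p - 1) * (F x ^ 2) ^ p := by
  have hC : 0 ≤ (16 * (p - 1)) ^ (p - 1) := Real.rpow_nonneg (by linarith) _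
  have hκ : Continuous fun q : ℝ × ℝ => max (q.2 - 2 * q.1 ^ 2) 0 ^ (p - 1) :=
    (Real.continuous_rpow_const (by linarith)).comp
      ((continuous_snd.sub (continuous_const.mul (continuous_fst.pow 2))).max continuous_const)
  have hc : Continuous fun q : ℝ × ℝ => (q.1 ^ 2) ^ (p - 1) :=
    (Real.continuous_rpow_const (by linarith)).comp (continuous_fst.pow 2)
  obtain ⟨hD, hD0⟩ := tsum_bellman_nonneg hK hK0 hKe
    (Φ := fun w v => (16 * (p - 1)) ^ (p - 1) * (w ^ 2) ^ p - max (v - 2 * w ^ 2) 0 ^ p)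
    (A := fun w v => p * ((16 * (p - 1)) ^ (p - 1) * ((w ^ 2) ^ (p - 1) * (2 * w)) +
          max (v - 2 * w ^ 2) 0 ^ (p - 1) * (4 * w)))
    (B := fun w v => -(p * max (v - 2 * w ^ 2) 0 ^ (p - 1)))
    (by
      intro a b a' b' t ha hb _
      have h1 := (ha.pow 2).rpow_const (p := p) (Or.inr (by linarith))
      have h2 := (hasDerivAt_max_zero_rpow (by linarith : 1 < p) (b t - 2 * a t ^ 2)).comp t
        (hb.sub ((ha.pow 2).const_mul 2))
      refine ((h1.const_mul _).sub h2).congr_deriv ?_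
      simp only [Pi.pow_apply]
      ring)
    (by fun_prop)
    (continuous_const.mul hκ).neg.continuousOn
    (fun w₁ w₂ v₁ v₂ _ _ => bellman_pair_of_two_le hp) hT F
  refine sum_le_tsum_sub_of_le hD ((summable_sq_rpow (by linarith) F).mul_left _) hD0
    (fun x => Real.rpow_nonneg (le_max_right _ _) _) (fun x => ?_) S
  have h1 : max (0 - 2 * semi K T F x ^ 2) 0 ^ p = 0 := by
    rw [max_eq_right (by linarith [sq_nonneg (semi K T F x)]), Real.zero_rpow (by linarith)]
  have h2 : 0 ≤ (16 * (p - 1)) ^ (p - 1) * (semi K T F x ^ 2) ^ p := by positivity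
  linarith

theorem sum_accum_rpow_le_large (hK : Summable K) (hK0 : ∀ z, 0 ≤ K z)
    (hKe : ∀ z, K (-z) = K z) {p : ℝ} (hp : 2 ≤ p) {T : ℝ} (hT : 0 ≤ T) (F : SeqL1)
    (S : Finset ℤ) :
    ∑ x ∈ S, accum K T F T x ^ p ≤
      2 ^ p * ((16 * (p - 1)) ^ (p - 1) + 2 ^ p) * ∑' x, (F x ^ 2) ^ p := by
  have hv : ∀ x, 0 ≤ accum K T F T x := accum_nonneg hK hK0 T F hT
  have hp0 : 0 ≤ p := by linarith
  have h1 := sum_max_rpow_le hK hK0 hKe hp hT F S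
  rw [tsum_mul_left] at h1
  have h2 := (summable_sq_rpow (by linarith : 1 ≤ p) F).sum_le_tsum S fun x _ => by positivity
  have h3 : ∀ x, accum K T F T x ^ p ≤
      2 ^ p * (max (accum K T F T x - 2 * F x ^ 2) 0 ^ p + 2 ^ p * (F x ^ 2) ^ p) := by
    intro x
    rw [← Real.mul_rpow (by norm_num) (sq_nonneg (F x))]
    refine le_trans (Real.rpow_le_rpow (hv x) ?_ hp0)
      (add_rpow_le hp0 (le_max_right _ _) (by positivity))
    linarith [le_max_left (accum K T F T x - 2 * F x ^ 2) 0]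
  refine (Finset.sum_le_sum fun x _ => h3 x).trans ?_
  rw [← Finset.mul_sum, Finset.sum_add_distrib, ← Finset.mul_sum, mul_assoc, add_mul]
  gcongr

theorem exists_sum_accum_rpow_le {p : ℝ} (hp : 1 ≤ p) :
    ∃ C : ℝ, 0 ≤ C ∧ ∀ K : ℤ → ℝ, Summable K → (∀ z, 0 ≤ K z) → (∀ z, K (-z) = K z) →
      ∀ T : ℝ, 0 ≤ T → ∀ (F : SeqL1) (S : Finset ℤ),
        ∑ x ∈ S, accum K T F T x ^ p ≤ C * ∑' x, (F x ^ 2) ^ p := by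
  rcases le_total p 2 with h | h
  · exact ⟨2 * (p * (2 * p) ^ (p - 1)), by positivity, fun K hK hK0 hKe T hT F S =>
      sum_accum_rpow_le_small hK hK0 hKe hp h hT F S⟩
  · have : 0 ≤ (16 * (p - 1)) ^ (p - 1) := Real.rpow_nonneg (by linarith) _
    exact ⟨2 ^ p * ((16 * (p - 1)) ^ (p - 1) + 2 ^ p), by positivity,
      fun K hK hK0 hKe T hT F S => sum_accum_rpow_le_large hK hK0 hKe h hT F S⟩

theorem mgradSq_nonneg {s : ℝ} (hs : s ∈ Set.Ioo (0 : ℝ) 1) (f : ℤ → ℝ) (x : ℤ) :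
    0 ≤ mgradSq s f x :=
  tsum_nonneg fun _ => mul_nonneg (Ker_nonneg hs _) (sq_nonneg _)

theorem hasSum_gradSq {s : ℝ} (hs : s ∈ Set.Ioo (0 : ℝ) 1) (F : SeqL1) (x : ℤ) :
    HasSum (fun y => Ker s (y - x) * (F x - F y) ^ 2) (carre (Ker s) F x) := by
  rw [← (Equiv.addLeft x).hasSum_iff]
  refine (hasSum_carre (Ker_summable hs) F x).congr_fun fun z => ?_
  simp

theorem mgradSq_le_carre {s : ℝ} (hs : s ∈ Set.Ioo (0 : ℝ) 1) (F : SeqL1) (x : ℤ) :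
    mgradSq s F x ≤ carre (Ker s) F x := by
  rw [← (hasSum_gradSq hs F x).tsum_eq]
  exact (hasSum_gradSq hs F x).summable.tsum_subtype_le _ {y | |F y| < |F x|}
    fun y => mul_nonneg (Ker_nonneg hs _) (sq_nonneg _)

theorem sq_sub_le_carre {s : ℝ} (hs : s ∈ Set.Ioo (0 : ℝ) 1) (F : SeqL1) (x : ℤ) :
    (F (x + 1) - F x) ^ 2 ≤ (Ker s 1)⁻¹ * carre (Ker s) F x := by
  rw [← div_eq_inv_mul, le_div_iff₀ (Ker_pos hs one_ne_zero)]
  have h := le_hasSum (hasSum_carre (Ker_summable hs) F x) 1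
    fun y _ => mul_nonneg (Ker_nonneg hs y) (sq_nonneg _)
  linarith

theorem tendsto_integral_carre {K : ℤ → ℝ} (hK : Summable K) (hK0 : ∀ z, 0 ≤ K z) {p : ℝ}
    (hp : 0 < p) {N : ℝ} (F : SeqL1) (x : ℤ)
    (hN : ∀ T : ℝ, 0 ≤ T → (∫ t in (0 : ℝ)..(2 * T), carre K (semi K t F) x) ^ p ≤ N) :
    IntegrableOn (fun t => carre K (semi K t F) x) (Set.Ioi 0) ∧
      Filter.Tendsto (fun T : ℝ => ∫ t in (0 : ℝ)..(2 * T), carre K (semi K t F) x) Filter.atTop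
        (nhds (∫ t in Set.Ioi (0 : ℝ), carre K (semi K t F) x)) := by
  have hcont := continuous_carre_semi_apply (K := K) F x
  have h2 : Filter.Tendsto (fun T : ℝ => 2 * T) Filter.atTop Filter.atTop :=
    Filter.tendsto_id.const_mul_atTop (by norm_num)
  have hint : IntegrableOn (fun t => carre K (semi K t F) x) (Set.Ioi 0) := by
    refine integrableOn_Ioi_of_intervalIntegral_norm_bounded (N ^ p⁻¹) 0
      (fun T => hcont.integrableOn_Ioc) h2 ?_
    filter_upwards [Filter.eventually_ge_atTop 0] with T hT
    have h0 : 0 ≤ ∫ t in (0 : ℝ)..(2 * T), carre K (semi K t F) x :=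
      intervalIntegral.integral_nonneg (by linarith) fun t _ => carre_nonneg hK hK0 _ x
    simp_rw [Real.norm_eq_abs, abs_of_nonneg (carre_nonneg hK hK0 _ x)]
    rw [Real.le_rpow_inv_iff_of_pos h0 ((Real.rpow_nonneg h0 p).trans (hN T hT)) hp]
    exact hN T hT
  exact ⟨hint, intervalIntegral_tendsto_integral_Ioi 0 hint h2⟩

theorem exists_integral_carre_bound {p : ℝ} (hp : 1 ≤ p) :
    ∃ C : ℝ, 0 ≤ C ∧ ∀ K : ℤ → ℝ, Summable K → (∀ z, 0 ≤ K z) → (∀ z, K (-z) = K z) →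
      ∀ F : SeqL1, (∀ x, IntegrableOn (fun t => carre K (semi K t F) x) (Set.Ioi 0)) ∧
        ∀ S : Finset ℤ, ∑ x ∈ S, (∫ t in Set.Ioi (0 : ℝ), carre K (semi K t F) x) ^ p ≤
          C * ∑' x, (F x ^ 2) ^ p := by
  obtain ⟨C, hC, hmain⟩ := exists_sum_accum_rpow_le hp
  refine ⟨2 ^ p * C, by positivity, fun K hK hK0 hKe F => ?_⟩
  have hp0 : 0 < p := by linarith
  have hfin : ∀ T : ℝ, 0 ≤ T → ∀ S : Finset ℤ,
      ∑ x ∈ S, (∫ t in (0 : ℝ)..(2 * T), carre K (semi K t F) x) ^ p ≤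
        2 ^ p * C * ∑' x, (F x ^ 2) ^ p := by
    intro T hT S
    calc _ ≤ ∑ x ∈ S, 2 ^ p * accum K T F T x ^ p := by
          refine Finset.sum_le_sum fun x _ => ?_
          rw [← Real.mul_rpow (by norm_num) (accum_nonneg hK hK0 T F hT x)]
          exact Real.rpow_le_rpow (intervalIntegral.integral_nonneg (by linarith)
            fun t _ => carre_nonneg hK hK0 _ x) (integral_carre_le_accum hK hK0 hT F x) hp0.le
      _ ≤ _ := by
          rw [← Finset.mul_sum, mul_assoc]
          exact mul_le_mul_of_nonneg_left (hmain K hK hK0 hKe T hT F S) (by positivity)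
  have hpt := fun x => tendsto_integral_carre hK hK0 hp0 F x fun T hT => by
    simpa using hfin T hT {x}
  refine ⟨fun x => (hpt x).1, fun S => ?_⟩
  refine le_of_tendsto (tendsto_finsetSum S fun x _ =>
    (hpt x).2.rpow_const (Or.inr hp0.le)) ?_
  filter_upwards [Filter.eventually_ge_atTop 0] with T hT using hfin T hT S

theorem lqNorm_sqrt_integral_le {q C c : ℝ} (hq : 2 ≤ q) (hC : 0 ≤ C) (hc : 0 < c)
    (F : SeqL1) {g m : ℤ → ℝ → ℝ} (hm0 : ∀ x, ∀ t ∈ Set.Ioi (0 : ℝ), 0 ≤ m x t)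
    (hm : ∀ x, ∀ t ∈ Set.Ioi (0 : ℝ), m x t ≤ c * g x t)
    (hg : ∀ x, IntegrableOn (g x) (Set.Ioi 0))
    (hS : ∀ S : Finset ℤ, ∑ x ∈ S, (∫ t in Set.Ioi (0 : ℝ), g x t) ^ (q / 2) ≤
      C * ∑' x, (F x ^ 2) ^ (q / 2)) :
    lqNorm q (fun x => Real.sqrt (∫ t in Set.Ioi (0 : ℝ), m x t)) ≤
      (c ^ (q / 2) * C) ^ (1 / q) * lqNorm q F := by
  have hsq : ∀ y : ℝ, (y ^ 2) ^ (q / 2) = |y| ^ q := by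
    intro y
    rw [← sq_abs, ← Real.rpow_natCast, ← Real.rpow_mul (abs_nonneg y)]
    congr 1
    push_cast
    ring
  have hI0 : ∀ x, 0 ≤ ∫ t in Set.Ioi (0 : ℝ), m x t := fun x =>
    setIntegral_nonneg measurableSet_Ioi (hm0 x)
  have hI : ∀ x, ∫ t in Set.Ioi (0 : ℝ), m x t ≤ c * ∫ t in Set.Ioi (0 : ℝ), g x t := by
    intro x
    rw [← integral_const_mul]
    exact integral_mono_of_nonneg ((ae_restrict_iff' measurableSet_Ioi).mpr (.of_forall (hm0 x)))
      ((hg x).const_mul c) ((ae_restrict_iff' measurableSet_Ioi).mpr (.of_forall (hm x)))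
  have hterm : ∀ x, |Real.sqrt (∫ t in Set.Ioi (0 : ℝ), m x t)| ^ q =
      (∫ t in Set.Ioi (0 : ℝ), m x t) ^ (q / 2) := fun x => by
    rw [← hsq, Real.sq_sqrt (hI0 x)]
  have hsum : ∀ S : Finset ℤ, ∑ x ∈ S, |Real.sqrt (∫ t in Set.Ioi (0 : ℝ), m x t)| ^ q ≤
      c ^ (q / 2) * C * ∑' x, |F x| ^ q := by
    intro S
    have hg0 : ∀ x, 0 ≤ ∫ t in Set.Ioi (0 : ℝ), g x t := fun x =>
      nonneg_of_mul_nonneg_right ((hI0 x).trans (hI x)) hc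
    calc _ ≤ ∑ x ∈ S, c ^ (q / 2) * (∫ t in Set.Ioi (0 : ℝ), g x t) ^ (q / 2) := by
          refine Finset.sum_le_sum fun x _ => ?_
          rw [hterm, ← Real.mul_rpow hc.le (hg0 x)]
          exact Real.rpow_le_rpow (hI0 x) (hI x) (by linarith)
      _ ≤ _ := by
          rw [← Finset.mul_sum, mul_assoc]
          simp_rw [hsq] at hS
          exact mul_le_mul_of_nonneg_left (hS S) (by positivity)
  have hF : 0 ≤ ∑' x, |F x| ^ q := tsum_nonneg fun x => by positivity
  unfold lqNorm
  rw [← Real.mul_rpow (by positivity) hF]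
  exact Real.rpow_le_rpow (tsum_nonneg fun x => by positivity)
    ((summable_of_sum_le (fun x => by positivity) hsum).tsum_le_of_sum_le hsum) (by positivity)

end SeqL1

/-- For every `q ∈ [2,∞)` there is `c_q > 0` (depending only on `q` and `s`) such that
both `‖G̃ f‖_q ≤ c_q ‖f‖_q` and `‖H f‖_q ≤ c_q ‖f‖_q` for every summable `f`. -/
theorem lq_bound_Gtilde_H_large_q (s : ℝ) (hs : s ∈ Set.Ioo (0 : ℝ) 1) (q : ℝ) (hq : 2 ≤ q) :
    ∃ c : ℝ, 0 < c ∧ ∀ f : ℤ → ℝ, Summable f →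
      lqNorm q (fun x => Real.sqrt (∫ t in Set.Ioi (0 : ℝ), mgradSq s (heat s t f) x)) ≤
        c * lqNorm q f ∧
      lqNorm q (fun x => Real.sqrt (∫ t in Set.Ioi (0 : ℝ),
        (heat s t f (x + 1) - heat s t f x) ^ 2)) ≤ c * lqNorm q f := by
  obtain ⟨C, hC, hmain⟩ := SeqL1.exists_integral_carre_bound (p := q / 2) (by linarith)
  have hk : 0 < (Ker s 1)⁻¹ := inv_pos.mpr (Ker_pos hs one_ne_zero)
  refine ⟨(1 ^ (q / 2) * C) ^ (1 / q) + ((Ker s 1)⁻¹ ^ (q / 2) * C) ^ (1 / q) + 1,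
    by positivity, fun f hf => ?_⟩
  obtain ⟨hint, hS⟩ := hmain (Ker s) (Ker_summable hs) (Ker_nonneg hs) (Ker_neg s) (SeqL1.mk f hf)
  have hheat : ∀ t, heat s t f = SeqL1.semi (Ker s) t (SeqL1.mk f hf) := fun t =>
    SeqL1.heat_coe hs t (SeqL1.mk f hf)
  have hn : 0 ≤ lqNorm q f := Real.rpow_nonneg (tsum_nonneg fun x => by positivity) _
  simp_rw [hheat]
  constructor
  · refine (SeqL1.lqNorm_sqrt_integral_le hq hC zero_lt_one (SeqL1.mk f hf)
      (fun x t _ => SeqL1.mgradSq_nonneg hs _ x)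
      (fun x t _ => (SeqL1.mgradSq_le_carre hs _ x).trans_eq (one_mul _).symm) hint hS).trans ?_
    refine mul_le_mul_of_nonneg_right ?_ hn
    have : 0 ≤ ((Ker s 1)⁻¹ ^ (q / 2) * C) ^ (1 / q) := by positivity
    linarith
  · refine (SeqL1.lqNorm_sqrt_integral_le hq hC hk (SeqL1.mk f hf)
      (fun x t _ => sq_nonneg _)
      (fun x t _ => SeqL1.sq_sub_le_carre hs _ x) hint hS).trans ?_
    refine mul_le_mul_of_nonneg_right ?_ hn
    have : 0 ≤ (1 ^ (q / 2) * C) ^ (1 / q) := by positivity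
    linarith
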